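/- Decryption succeeds with probability 1: in the setting of the protocol, let ψ_f = (U^t)†(T_m ⊗ I_c)U^t(|l⟩⊗|s⟩) be the state before measurement. Then for the position measurement, the probability of outcome i, given by ‖(|i⟩⟨i| ⊗ I_c) ψ_f‖², equals 1 if i = l + m (in ZMod N) and equals 0 for every other i. -/

import Mathlib

/-!
STATEMENT 10: Decryption succeeds with probability 1: in the setting of the
protocol, let ψ_f = (U^t)†(T_m ⊗ I_c)U^t(|l⟩⊗|s⟩) be the state before
measurement.  Then for the position measurement, the probability of outcome i,
given by ‖(|i⟩⟨i| ⊗ I_c) ψ_f‖², equals 1 if i = l + m (in ZMod N) and equals 0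
for every other i.

The tensor space ℂ^(ZMod N) ⊗ ℂ² is modelled as
`EuclideanSpace ℂ (ZMod N × Fin 2)` with basis vector |i⟩⊗|s⟩ = `ket N i s`;
coin states |L⟩ = 0, |R⟩ = 1 in Fin 2.  T_m ⊗ I_c is the (unique) operator
`TT m` with (T_m ⊗ I_c)(|i⟩⊗|s⟩) = |i+m⟩⊗|s⟩, the shift S is characterized by
its action on the basis, I_p ⊗ U_c is the (unique) operator W with
W(|i⟩⊗|s⟩) = |i⟩ ⊗ (U_c|s⟩), and |i⟩⟨i| ⊗ I_c is the (unique) orthogonal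
projection `P i` with (|i⟩⟨i| ⊗ I_c)(|j⟩⊗|s⟩) = |j⟩⊗|s⟩ if j = i and 0
otherwise.
-/

/-- The basis vector |i⟩⊗|s⟩ of the walker's Hilbert space ℂ^(ZMod N) ⊗ ℂ². -/
noncomputable def ket (N : ℕ) (i : ZMod N) (s : Fin 2) :
    EuclideanSpace ℂ (ZMod N × Fin 2) :=
  EuclideanSpace.single (i, s) 1

/-- Bounded operators that agree on all vectors |i⟩⊗|s⟩ are equal. -/
theorem ext_ket {N : ℕ} [NeZero N]
    {A B : EuclideanSpace ℂ (ZMod N × Fin 2) →L[ℂ] EuclideanSpace ℂ (ZMod N × Fin 2)}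
    (h : ∀ i s, A (ket N i s) = B (ket N i s)) : A = B := by
  apply ContinuousLinearMap.coe_injective
  refine (EuclideanSpace.basisFun (ZMod N × Fin 2) ℂ).toBasis.ext fun p => ?_
  simpa [ket] using h p.1 p.2

theorem inner_ket {N : ℕ} [NeZero N] (i j : ZMod N) (s r : Fin 2) :
    inner ℂ (ket N i s) (ket N j r) = if i = j ∧ s = r then (1 : ℂ) else 0 := by
  simp [ket, EuclideanSpace.inner_single_left, Prod.ext_iff]

/-- An operator preserving the inner products of the vectors |i⟩⊗|s⟩ is an isometry. -/
theorem star_mul_self_eq_one_of_inner_ket {N : ℕ} [NeZero N]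
    {A : EuclideanSpace ℂ (ZMod N × Fin 2) →L[ℂ] EuclideanSpace ℂ (ZMod N × Fin 2)}
    (h : ∀ i s j r, inner ℂ (A (ket N i s)) (A (ket N j r)) =
      inner ℂ (ket N i s) (ket N j r)) : star A * A = 1 := by
  refine ext_ket fun j r => ?_
  ext p
  have := h p.1 p.2 j r
  rw [← ContinuousLinearMap.adjoint_inner_right] at this
  simpa [ket, EuclideanSpace.inner_single_left, ContinuousLinearMap.star_eq_adjoint] using this

theorem star_pow_mul_pow_eq_one {M : Type*} [Monoid M] [StarMul M] {a : M}
    (h : star a * a = 1) (t : ℕ) : star (a ^ t) * a ^ t = 1 := by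
  induction t with
  | zero => simp
  | succ t ih =>
    rw [pow_succ, star_mul, mul_assoc, ← mul_assoc (star (a ^ t)), ih, one_mul, h]

theorem decryption_probability_one (N : ℕ) [NeZero N]
    (Uc : Matrix (Fin 2) (Fin 2) ℂ) (hUc : Uc ∈ Matrix.unitaryGroup (Fin 2) ℂ)
    (S : EuclideanSpace ℂ (ZMod N × Fin 2) →L[ℂ] EuclideanSpace ℂ (ZMod N × Fin 2))
    (hSR : ∀ i : ZMod N, S (ket N i 1) = ket N (i + 1) 1)
    (hSL : ∀ i : ZMod N, S (ket N i 0) = ket N (i - 1) 0)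
    (W : EuclideanSpace ℂ (ZMod N × Fin 2) →L[ℂ] EuclideanSpace ℂ (ZMod N × Fin 2))
    (hW : ∀ (i : ZMod N) (s : Fin 2),
      W (ket N i s) = Uc 0 s • ket N i 0 + Uc 1 s • ket N i 1)
    (TT : ZMod N →
      (EuclideanSpace ℂ (ZMod N × Fin 2) →L[ℂ] EuclideanSpace ℂ (ZMod N × Fin 2)))
    (hTT : ∀ (m i : ZMod N) (s : Fin 2), TT m (ket N i s) = ket N (i + m) s)
    (P : ZMod N →
      (EuclideanSpace ℂ (ZMod N × Fin 2) →L[ℂ] EuclideanSpace ℂ (ZMod N × Fin 2)))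
    (hP : ∀ (i j : ZMod N) (s : Fin 2),
      P i (ket N j s) = if j = i then ket N j s else 0)
    (t : ℕ) (l m : ZMod N) (s : Fin 2)
    (ψf : EuclideanSpace ℂ (ZMod N × Fin 2))
    (hψf : ψf =
      ContinuousLinearMap.adjoint ((S ∘L W) ^ t) (TT m (((S ∘L W) ^ t) (ket N l s)))) :
    ∀ i : ZMod N, ‖P i ψf‖ ^ 2 = if i = l + m then (1 : ℝ) else 0 := by
  have hS : star S * S = 1 := star_mul_self_eq_one_of_inner_ket fun i a j b => by
    fin_cases a <;> fin_cases b <;> simp [hSR, hSL, inner_ket]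
  have hUU : ∀ a b : Fin 2, star (Uc 0 a) * Uc 0 b + star (Uc 1 a) * Uc 1 b =
      if a = b then 1 else 0 := fun a b => by
    have h := congrFun₂ (Matrix.mem_unitaryGroup_iff'.mp hUc) a b
    simpa [Matrix.mul_apply, Fin.sum_univ_two, Matrix.star_apply, Matrix.one_apply] using h
  have hWW : star W * W = 1 := star_mul_self_eq_one_of_inner_ket fun i a j b => by
    have h := hUU a b
    simp only [hW, inner_add_left, inner_add_right, inner_smul_left, inner_smul_right, inner_ket]
    by_cases hij : i = j
    · simpa [hij, mul_comm] using h
    · simp [hij]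
  have hU : star (S * W) * (S * W) = 1 := by
    rw [star_mul, mul_assoc, ← mul_assoc (star S), hS, one_mul, hWW]
  have hcomm : Commute (TT m) (S * W) := by
    refine Commute.mul_right (ext_ket fun i a => ?_) (ext_ket fun i a => ?_)
    · fin_cases a <;> simp [hSR, hSL, hTT, add_right_comm, sub_add_eq_add_sub]
    · simp [hW, hTT]
  have hψ : ψf = ket N (l + m) s := by
    have h : star ((S * W) ^ t) * (TT m * (S * W) ^ t) = TT m := by
      rw [(hcomm.pow_right t).eq, ← mul_assoc, star_pow_mul_pow_eq_one hU, one_mul]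
    rw [hψf, ← hTT m l s]
    exact DFunLike.congr_fun h (ket N l s)
  intro i
  rw [hψ, hP]
  by_cases hi : i = l + m
  · simp [hi, ket]
  · simp [hi, Ne.symm hi]
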